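/- arXiv:2601.08488 — 4 statements merged into one kernel-verified Lean document; each statement's English description precedes it below -/
import Mathlib

section
/- Let Ā, B̄, Q, R = TᵀT (T invertible), and a symmetric P satisfying Āᵀ P + P Ā − P B̄ R⁻¹ B̄ᵀ P + Q = 0, with Q positive semidefinite. Let x : [0,∞) → ℝᴺ be differentiable and u : [0,∞) → ℝᵐ continuous with ẋ(t) = Ā x(t) + B̄ u(t), and suppose x(t)ᵀ P x(t) → 0 as t → ∞. Then the cost J = ∫₀^∞ ( x(t)ᵀ Q x(t) + u(t)ᵀ R u(t) ) dt (as an improper Lebesgue integral, possibly +∞) satisfies J ≥ x(0)ᵀ P x(0). -/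
open Matrix MeasureTheory Filter

/-- If `V` tends to zero and `-V'` is bounded by the nonnegative rate `L`, then the total cost
`∫₀^∞ L` is at least `V 0`. -/
theorem ofReal_le_lintegral_of_neg_deriv_le {V V' L : ℝ → ℝ}
    (hV : ∀ t, 0 ≤ t → HasDerivAt V (V' t) t) (hV' : ContinuousOn V' (Set.Ici 0))
    (hL : ContinuousOn L (Set.Ici 0)) (hL₀ : ∀ t, 0 ≤ L t) (hle : ∀ t, 0 ≤ V' t + L t)
    (hlim : Tendsto V atTop (nhds 0)) :
    ENNReal.ofReal (V 0) ≤ ∫⁻ t in Set.Ioi (0 : ℝ), ENNReal.ofReal (L t) := by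
  have hsub : Tendsto (fun s => ENNReal.ofReal (V 0 - V s)) atTop
      (nhds (ENNReal.ofReal (V 0))) := by
    simpa using ENNReal.tendsto_ofReal (hlim.const_sub (V 0))
  refine le_of_tendsto hsub ?_
  filter_upwards [eventually_ge_atTop (0 : ℝ)] with s hs
  have hIcc : Set.uIcc 0 s ⊆ Set.Ici 0 := by
    rw [Set.uIcc_of_le hs]
    exact Set.Icc_subset_Ici_self
  have iV : IntervalIntegrable V' volume 0 s := (hV'.mono hIcc).intervalIntegrable
  have iL : IntervalIntegrable L volume 0 s := (hL.mono hIcc).intervalIntegrable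
  have hftc : ∫ t in (0 : ℝ)..s, V' t = V s - V 0 :=
    intervalIntegral.integral_eq_sub_of_hasDerivAt (fun t ht => hV t (hIcc ht)) iV
  have hnonneg : 0 ≤ ∫ t in (0 : ℝ)..s, (V' t + L t) :=
    intervalIntegral.integral_nonneg hs fun t _ => hle t
  rw [intervalIntegral.integral_add iV iL, hftc] at hnonneg
  calc ENNReal.ofReal (V 0 - V s) ≤ ENNReal.ofReal (∫ t in (0 : ℝ)..s, L t) :=
        ENNReal.ofReal_le_ofReal (by linarith)
    _ = ∫⁻ t in Set.Ioc 0 s, ENNReal.ofReal (L t) := by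
        rw [intervalIntegral.integral_of_le hs]
        exact ofReal_integral_eq_lintegral_ofReal iL.1 (Eventually.of_forall hL₀)
    _ ≤ ∫⁻ t in Set.Ioi (0 : ℝ), ENNReal.ofReal (L t) :=
        lintegral_mono_set Set.Ioc_subset_Ioi_self

theorem hasDerivAt_dotProduct_mulVec {n : Type*} [Fintype n] (P : Matrix n n ℝ)
    {x : ℝ → n → ℝ} {x' : n → ℝ} {t : ℝ} (hx : HasDerivAt x x' t) :
    HasDerivAt (fun s => x s ⬝ᵥ P *ᵥ x s) (x' ⬝ᵥ P *ᵥ x t + x t ⬝ᵥ P *ᵥ x') t := by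
  have hc := hasDerivAt_pi.1 hx
  have hP : ∀ i, HasDerivAt (fun s => (P *ᵥ x s) i) ((P *ᵥ x') i) t := fun i =>
    HasDerivAt.fun_sum fun j _ => (hc j).const_mul (P i j)
  simp only [dotProduct, ← Finset.sum_add_distrib]
  exact HasDerivAt.fun_sum fun i _ => (hc i).mul (hP i)

theorem continuousOn_dotProduct {n : Type*} [Fintype n] {f g : ℝ → n → ℝ} {s : Set ℝ}
    (hf : ContinuousOn f s) (hg : ContinuousOn g s) :
    ContinuousOn (fun t => f t ⬝ᵥ g t) s :=
  continuousOn_finsetSum _ fun i _ =>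
    (continuousOn_pi.1 hf i).mul (continuousOn_pi.1 hg i)

theorem continuousOn_mulVec {k n : Type*} [Fintype n] (M : Matrix k n ℝ) {f : ℝ → n → ℝ}
    {s : Set ℝ} (hf : ContinuousOn f s) : ContinuousOn (fun t => M *ᵥ f t) s :=
  (continuous_const.matrix_mulVec continuous_id).comp_continuousOn hf

/-- Completion of the square: along the dynamics, the derivative of `xᵀPx` plus the running cost
is the quadratic form of `R` at `u + R⁻¹BᵀPx`. -/
theorem riccati_complete_square {n k : Type*} [Fintype n] [Fintype k] [DecidableEq k]
    {A Q P : Matrix n n ℝ} {B : Matrix n k ℝ} {R : Matrix k k ℝ}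
    (hR : IsUnit R.det) (hRsymm : R.IsSymm) (hP : P.IsSymm)
    (hRic : Aᵀ * P + P * A - P * B * R⁻¹ * Bᵀ * P + Q = 0) (x : n → ℝ) (u : k → ℝ) :
    (A *ᵥ x + B *ᵥ u) ⬝ᵥ P *ᵥ x + x ⬝ᵥ P *ᵥ (A *ᵥ x + B *ᵥ u) +
        (x ⬝ᵥ Q *ᵥ x + u ⬝ᵥ R *ᵥ u) =
      (u + R⁻¹ *ᵥ (Bᵀ *ᵥ (P *ᵥ x))) ⬝ᵥ R *ᵥ (u + R⁻¹ *ᵥ (Bᵀ *ᵥ (P *ᵥ x))) := by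
  have hadj : ∀ y, x ⬝ᵥ P *ᵥ y = (P *ᵥ x) ⬝ᵥ y := fun y => by
    rw [dotProduct_mulVec, ← mulVec_transpose, hP.eq]
  have hadjB : ∀ v : k → ℝ, (P *ᵥ x) ⬝ᵥ B *ᵥ v = (Bᵀ *ᵥ (P *ᵥ x)) ⬝ᵥ v := fun v => by
    rw [dotProduct_mulVec, ← mulVec_transpose]
  have hadjR : ∀ v w, v ⬝ᵥ R *ᵥ w = (R *ᵥ v) ⬝ᵥ w := fun v w => by
    rw [dotProduct_mulVec, ← mulVec_transpose, hRsymm.eq]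
  have hinv : ∀ w, R *ᵥ (R⁻¹ *ᵥ w) = w := fun w => by
    rw [mulVec_mulVec, mul_nonsing_inv _ hR, one_mulVec]
  have hquad := congrArg (fun M => x ⬝ᵥ M *ᵥ x) hRic
  simp only [add_mulVec, sub_mulVec, dotProduct_add, dotProduct_sub, ← mulVec_mulVec,
    zero_mulVec, dotProduct_zero, hadj, hadjB] at hquad
  rw [dotProduct_mulVec x Aᵀ, vecMul_transpose] at hquad
  have hcross : (R⁻¹ *ᵥ (Bᵀ *ᵥ (P *ᵥ x))) ⬝ᵥ R *ᵥ u = (Bᵀ *ᵥ (P *ᵥ x)) ⬝ᵥ u := by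
    rw [hadjR, hinv]
  simp only [mulVec_add, add_dotProduct, dotProduct_add, hadj, hadjB, hcross, hinv]
  rw [dotProduct_comm (B *ᵥ u), hadjB, dotProduct_comm u (Bᵀ *ᵥ (P *ᵥ x)),
    dotProduct_comm (R⁻¹ *ᵥ _)]
  linarith

/-- with `Q` positive semidefinite, `R = TᵀT` (`T` invertible), `P` a
symmetric solution of the ARE, and a trajectory of `ẋ = Āx + B̄u` (for `t ≥ 0`,
`u` continuous on `[0,∞)`) along which `x(t)ᵀPx(t) → 0`, the cost
`J = ∫₀^∞ (xᵀQx + uᵀRu) dt` (improper Lebesgue integral, possibly `+∞`)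
satisfies `J ≥ x(0)ᵀPx(0)`. -/
theorem stmt_7 (N m : ℕ)
    (A : Matrix (Fin N) (Fin N) ℝ)
    (B : Matrix (Fin N) (Fin m) ℝ)
    (Q : Matrix (Fin N) (Fin N) ℝ) (hQ : Q.PosSemidef)
    (T : Matrix (Fin m) (Fin m) ℝ) (hT : IsUnit T.det)
    (R : Matrix (Fin m) (Fin m) ℝ) (hR : R = Tᵀ * T)
    (P : Matrix (Fin N) (Fin N) ℝ) (hPsymm : P.IsSymm)
    (hRic : Aᵀ * P + P * A - P * B * R⁻¹ * Bᵀ * P + Q = 0)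
    (x : ℝ → Fin N → ℝ) (u : ℝ → Fin m → ℝ)
    (hx : ∀ t : ℝ, 0 ≤ t → HasDerivAt x (A.mulVec (x t) + B.mulVec (u t)) t)
    (hu : ContinuousOn u (Set.Ici 0))
    (hlim : Tendsto (fun t => x t ⬝ᵥ P.mulVec (x t)) atTop (nhds 0)) :
    ENNReal.ofReal (x 0 ⬝ᵥ P.mulVec (x 0)) ≤
      ∫⁻ t in Set.Ioi (0 : ℝ),
        ENNReal.ofReal (x t ⬝ᵥ Q.mulVec (x t) + u t ⬝ᵥ R.mulVec (u t)) := by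
  have hRdet : IsUnit R.det := by
    rw [hR, det_mul, det_transpose]
    exact hT.mul hT
  have hRpos : R.PosSemidef := by
    rw [hR, ← conjTranspose_eq_transpose_of_trivial]
    exact posSemidef_conjTranspose_mul_self T
  have hRsymm : R.IsSymm := by
    rw [hR]
    exact isSymm_transpose_mul_self T
  have hRnn : ∀ v, 0 ≤ v ⬝ᵥ R *ᵥ v := fun v => by
    simpa using hRpos.dotProduct_mulVec_nonneg v
  have hQnn : ∀ v, 0 ≤ v ⬝ᵥ Q *ᵥ v := fun v => by
    simpa using hQ.dotProduct_mulVec_nonneg v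
  have hxc : ContinuousOn x (Set.Ici 0) := fun t ht =>
    (hx t ht).continuousAt.continuousWithinAt
  have hxc' := (continuousOn_mulVec A hxc).add (continuousOn_mulVec B hu)
  refine ofReal_le_lintegral_of_neg_deriv_le
    (V := fun t => x t ⬝ᵥ P *ᵥ x t)
    (fun t ht => hasDerivAt_dotProduct_mulVec P (hx t ht)) ?_ ?_ ?_ ?_ hlim
  · exact (continuousOn_dotProduct hxc' (continuousOn_mulVec P hxc)).add
      (continuousOn_dotProduct hxc (continuousOn_mulVec P hxc'))
  · exact (continuousOn_dotProduct hxc (continuousOn_mulVec Q hxc)).add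
      (continuousOn_dotProduct hu (continuousOn_mulVec R hu))
  · exact fun t => add_nonneg (hQnn _) (hRnn _)
  · intro t
    rw [riccati_complete_square hRdet hRsymm hPsymm hRic]
    exact hRnn _
end

section
/- Let A ∈ ℝ^{n×n}, b_u, b_d ∈ ℝⁿ, c ∈ ℝ^{1×n}, and ū_c ∈ ℝ^{1×n} with M := A + b_u ū_c invertible and c M⁻¹ b_u ≠ 0, and let u_d = −( c M⁻¹ b_u )⁻¹ ( c M⁻¹ b_d ). Let ω ∈ ℝ be a constant disturbance and let x* ∈ ℝⁿ be an equilibrium of the compensated closed loop, i.e. M x* + ( b_u u_d + b_d ) ω = 0. Then the steady-state output is zero: c x* = 0. In particular, the constant mismatched disturbance ω has no effect on the steady-state output. -/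
open Matrix

/-- with `M = A + b_u ū_c` invertible, `c M⁻¹ b_u ≠ 0` and the
compensation gain `u_d = −(c M⁻¹ b_u)⁻¹ (c M⁻¹ b_d)`, any equilibrium `x*` of the
compensated closed loop `M x* + (b_u u_d + b_d) ω = 0` (with constant disturbance
`ω`) has zero steady-state output `c x* = 0`. -/
theorem stmt_13 (n : ℕ)
    (A : Matrix (Fin n) (Fin n) ℝ)
    (bu bd : Fin n → ℝ)
    (c : Fin n → ℝ)
    (uc : Fin n → ℝ)
    (M : Matrix (Fin n) (Fin n) ℝ) (hM : M = A + Matrix.vecMulVec bu uc)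
    (hMinv : IsUnit M.det)
    (hcb : c ⬝ᵥ M⁻¹.mulVec bu ≠ 0)
    (ud : ℝ) (hud : ud = -(c ⬝ᵥ M⁻¹.mulVec bu)⁻¹ * (c ⬝ᵥ M⁻¹.mulVec bd))
    (ω : ℝ) (xstar : Fin n → ℝ)
    (heq : M.mulVec xstar + ω • (ud • bu + bd) = 0) :
    c ⬝ᵥ xstar = 0 := by
  have h := congrArg (fun v => c ⬝ᵥ M⁻¹.mulVec v) heq
  simp only [mulVec_add, mulVec_smul, mulVec_mulVec, nonsing_inv_mul M hMinv, one_mulVec,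
    dotProduct_add, dotProduct_smul, mulVec_zero, dotProduct_zero, smul_eq_mul] at h
  have hcancel : ud * (c ⬝ᵥ M⁻¹.mulVec bu) + c ⬝ᵥ M⁻¹.mulVec bd = 0 := by
    rw [hud]
    field_simp
    ring
  simpa [hcancel] using h
end

section
/- Let A ∈ ℝ^{n×n}, b_u, b_d ∈ ℝⁿ, c ∈ ℝ^{1×n}, ū_c ∈ ℝ^{1×n} with M := A + b_u ū_c invertible and c M⁻¹ b_u ≠ 0, and u_d = −( c M⁻¹ b_u )⁻¹ ( c M⁻¹ b_d ). Let x : ℝ → ℝⁿ be differentiable, e : ℝ → ℝ, and ω : ℝ → ℝ, and suppose the closed-loop dynamics ẋ(t) = M x(t) − b_u u_d e(t) + ( b_d + b_u u_d ) ω(t) holds for all t. Then the output y(t) = c x(t) satisfies the decomposition y(t) = c M⁻¹ ẋ(t) + c M⁻¹ b_u u_d e(t) for all t; in particular, the disturbance ω does not appear in this expression for the output. -/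
open Matrix

/-- along the compensated closed loop
`ẋ = M x − b_u u_d e + (b_d + b_u u_d) ω`, the output `y = c x` decomposes as
`y(t) = c M⁻¹ ẋ(t) + (c M⁻¹ b_u) u_d e(t)`; the disturbance `ω` does not appear. -/
theorem stmt_14 (n : ℕ)
    (A : Matrix (Fin n) (Fin n) ℝ)
    (bu bd : Fin n → ℝ)
    (c : Fin n → ℝ)
    (uc : Fin n → ℝ)
    (M : Matrix (Fin n) (Fin n) ℝ) (hM : M = A + Matrix.vecMulVec bu uc)
    (hMinv : IsUnit M.det)
    (hcb : c ⬝ᵥ M⁻¹.mulVec bu ≠ 0)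
    (ud : ℝ) (hud : ud = -(c ⬝ᵥ M⁻¹.mulVec bu)⁻¹ * (c ⬝ᵥ M⁻¹.mulVec bd))
    (x x' : ℝ → Fin n → ℝ) (e ω : ℝ → ℝ)
    (hx : ∀ t : ℝ, HasDerivAt x (x' t) t)
    (hdyn : ∀ t : ℝ,
      x' t = M.mulVec (x t) - (ud * e t) • bu + ω t • (bd + ud • bu)) :
    ∀ t : ℝ, c ⬝ᵥ x t =
      c ⬝ᵥ M⁻¹.mulVec (x' t) + (c ⬝ᵥ M⁻¹.mulVec bu) * (ud * e t) := by
  intro t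
  have h_comp : c ⬝ᵥ M⁻¹ *ᵥ bd + ud * (c ⬝ᵥ M⁻¹ *ᵥ bu) = 0 := by
    rw [hud]
    field_simp
    ring
  have h_state : M⁻¹ *ᵥ M *ᵥ x t = x t := by
    rw [mulVec_mulVec, nonsing_inv_mul _ hMinv, one_mulVec]
  rw [hdyn t, mulVec_add, mulVec_sub, h_state]
  simp only [mulVec_smul, mulVec_add, dotProduct_add, dotProduct_sub, dotProduct_smul,
    smul_eq_mul]
  linear_combination -ω t * h_comp
end

section
/- Under the setup of the composite disturbance-observer-based tracking controller — A ∈ ℝ^{n×n}, b_u, b_d ∈ ℝⁿ, c ∈ ℝ^{1×n}, ū_c ∈ ℝ^{1×n} with M := A + b_u ū_c invertible and c M⁻¹ b_u ≠ 0, u_d = −( c M⁻¹ b_u )⁻¹ ( c M⁻¹ b_d ) — let x : ℝ → ℝⁿ be differentiable, e : ℝ → ℝ, ω : ℝ → ℝ, and suppose ẋ(t) = M x(t) − b_u u_d e(t) + ( b_d + b_u u_d ) ω(t) for all t. If ẋ(t) → 0 and e(t) → 0 as t → ∞, then the output y(t) = c x(t) → 0 as t → ∞; that is, the effect of the mismatched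 disturbance is asymptotically removed from the output. -/
open Matrix Filter

/-- along the compensated closed loop
`ẋ = M x − b_u u_d e + (b_d + b_u u_d) ω`, if `ẋ(t) → 0` and `e(t) → 0` as
`t → ∞`, then the output `y(t) = c x(t) → 0`: the effect of the mismatched
disturbance is asymptotically removed from the output. -/
theorem stmt_15 (n : ℕ)
    (A : Matrix (Fin n) (Fin n) ℝ)
    (bu bd : Fin n → ℝ)
    (c : Fin n → ℝ)
    (uc : Fin n → ℝ)
    (M : Matrix (Fin n) (Fin n) ℝ) (hM : M = A + Matrix.vecMulVec bu uc)
    (hMinv : IsUnit M.det)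
    (hcb : c ⬝ᵥ M⁻¹.mulVec bu ≠ 0)
    (ud : ℝ) (hud : ud = -(c ⬝ᵥ M⁻¹.mulVec bu)⁻¹ * (c ⬝ᵥ M⁻¹.mulVec bd))
    (x x' : ℝ → Fin n → ℝ) (e ω : ℝ → ℝ)
    (hx : ∀ t : ℝ, HasDerivAt x (x' t) t)
    (hdyn : ∀ t : ℝ,
      x' t = M.mulVec (x t) - (ud * e t) • bu + ω t • (bd + ud • bu))
    (hx' : Tendsto x' atTop (nhds 0))
    (he : Tendsto e atTop (nhds 0)) :
    Tendsto (fun t => c ⬝ᵥ x t) atTop (nhds 0) := by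
  have hout : ∀ t, c ⬝ᵥ x t =
      c ⬝ᵥ M⁻¹.mulVec (x' t) + ud * e t * (c ⬝ᵥ M⁻¹.mulVec bu) := by
    intro t
    have hcancel : (c ⬝ᵥ M⁻¹.mulVec bd) + ud * (c ⬝ᵥ M⁻¹.mulVec bu) = 0 := by
      rw [hud]
      field_simp
      ring
    rw [hdyn t]
    simp only [mulVec_add, mulVec_sub, mulVec_smul, mulVec_mulVec, nonsing_inv_mul M hMinv,
      one_mulVec, dotProduct_add, dotProduct_sub, dotProduct_smul, smul_eq_mul]
    linear_combination (-ω t) * hcancel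
  have hderiv : Tendsto (fun t => c ⬝ᵥ M⁻¹.mulVec (x' t)) atTop (nhds 0) := by
    have hcont : Continuous fun v : Fin n → ℝ => c ⬝ᵥ M⁻¹.mulVec v := by fun_prop
    simpa [Function.comp_def] using (hcont.tendsto 0).comp hx'
  have herr : Tendsto (fun t => ud * e t * (c ⬝ᵥ M⁻¹.mulVec bu)) atTop (nhds 0) := by
    simpa using (he.const_mul ud).mul_const (c ⬝ᵥ M⁻¹.mulVec bu)
  simpa [hout] using hderiv.add herr
end
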